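/- arXiv:2602.24165 — 2 statements merged into one kernel-verified Lean document; each statement's English description precedes it below -/
import Mathlib

section
/- Let X be a measurable space and let M0, M1 be two convex sets of probability measures on X, all dominated by a common σ-finite measure μ, and suppose there exists ε > 0 such that inf_{P ∈ M0, Q ∈ M1} h(P, Q) ≥ ε. Then there exist a constant c > 0 and a sequence of tests φ_n : Xⁿ → {0,1} such that for all n, α_n(φ_n) = sup_{P ∈ M0} Pⁿ(φ_n = 1) ≤ exp(−c n ε²) and β_n(φ_n) = sup_{Q ∈ M1} Qⁿ(φ_n = 0) ≤ exp(−c n ε²). -/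
open MeasureTheory Filter

/-- Hellinger distance between measures `P, Q` dominated by `μ`,
computed from their densities (Radon–Nikodym derivatives) with respect
to `μ`: `h(P,Q) = √((1/2) ∫ (√(dP/dμ) − √(dQ/dμ))² dμ)`. -/
noncomputable def hellingerDist' {X : Type*} [MeasurableSpace X]
    (μ P Q : Measure X) : ℝ :=
  Real.sqrt ((1 / 2) * ∫ x,
    (Real.sqrt ((P.rnDeriv μ x).toReal) - Real.sqrt ((Q.rnDeriv μ x).toReal)) ^ 2 ∂μ)

section Separation

variable {X : Type*} [MeasurableSpace X]

/-- The restriction to `L²` of a continuous linear functional on `L¹` of a finite measure is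
given by integration against an `L²` function. -/
lemma exists_integrable_setIntegral_eq_of_L1_dual (ν : Measure X) [IsFiniteMeasure ν]
    (L : StrongDual ℝ (X →₁[ν] ℝ)) :
    ∃ φ : X → ℝ, Integrable φ ν ∧ ∀ (s : Set X) (hs : MeasurableSet s),
      L (((integrable_const (1 : ℝ)).indicator hs).toL1 (s.indicator fun _ => (1 : ℝ)))
        = ∫ x in s, φ x ∂ν := by
  have hint : ∀ f : Lp ℝ 2 ν, Integrable f ν := fun f =>
    (Lp.memLp f).integrable (by norm_num)
  let T : Lp ℝ 2 ν →ₗ[ℝ] (X →₁[ν] ℝ) :=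
    { toFun := fun f => (hint f).toL1 f
      map_add' := fun f g => by
        rw [← Integrable.toL1_add]
        exact (Integrable.toL1_eq_toL1_iff _ _ _ _).2 (Lp.coeFn_add f g)
      map_smul' := fun r f => by
        rw [RingHom.id_apply, ← Integrable.toL1_smul']
        exact (Integrable.toL1_eq_toL1_iff _ _ _ _).2 (Lp.coeFn_smul r f) }
  let K : ENNReal := ν Set.univ ^ (1 / (1 : ENNReal).toReal - 1 / (2 : ENNReal).toReal)
  have hK : K ≠ ⊤ := ENNReal.rpow_ne_top_of_nonneg (by norm_num) (measure_ne_top _ _)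
  let T' : Lp ℝ 2 ν →L[ℝ] (X →₁[ν] ℝ) := T.mkContinuous K.toReal fun f => by
    change ‖(hint f).toL1 f‖ ≤ _
    rw [Integrable.toL1, Lp.norm_toLp, Lp.norm_def, ← ENNReal.toReal_mul, mul_comm]
    refine ENNReal.toReal_mono (ENNReal.mul_ne_top (Lp.eLpNorm_ne_top f) hK) ?_
    exact eLpNorm_le_eLpNorm_mul_rpow_measure_univ (by norm_num) (Lp.aestronglyMeasurable f)
  let φ := (InnerProductSpace.toDual ℝ (Lp ℝ 2 ν)).symm (L.comp T')
  refine ⟨φ, hint φ, fun s hs => ?_⟩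
  have h := InnerProductSpace.toDual_symm_apply (𝕜 := ℝ)
    (x := indicatorConstLp 2 hs (measure_ne_top ν s) (1 : ℝ)) (y := L.comp T')
  rw [real_inner_comm, L2.inner_indicatorConstLp_one] at h
  rw [h]
  change _ = L ((hint _).toL1 _)
  congr 1
  exact (Integrable.toL1_eq_toL1_iff _ _ _ _).2 indicatorConstLp_coeFn.symm

/-- A continuous linear functional on `L¹` of a finite measure is given by integration against
a bounded measurable function. -/
lemma exists_bounded_integral_eq_of_L1_dual (ν : Measure X) [IsFiniteMeasure ν]
    (L : StrongDual ℝ (X →₁[ν] ℝ)) :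
    ∃ ψ : X → ℝ, Measurable ψ ∧ (∀ x, ψ x ∈ Set.Icc (-‖L‖) ‖L‖) ∧
      ∀ (g : X → ℝ) (hg : Integrable g ν), L (hg.toL1 g) = ∫ x, g x * ψ x ∂ν := by
  obtain ⟨φ, hφ, hL⟩ := exists_integrable_setIntegral_eq_of_L1_dual ν L
  have hbound : ∀ s, MeasurableSet s → |∫ x in s, φ x ∂ν| ≤ ∫ _ in s, ‖L‖ ∂ν := fun s hs => by
    rw [← hL s hs, ← Real.norm_eq_abs]
    refine (L.le_opNorm _).trans_eq ?_
    rw [setIntegral_const, smul_eq_mul, mul_comm, L1.norm_of_fun_eq_integral_norm]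
    congr 1
    simp_rw [norm_indicator_eq_indicator_norm]
    simp [integral_indicator hs]
  have hle : φ ≤ᵐ[ν] fun _ => ‖L‖ :=
    ae_le_of_forall_setIntegral_le hφ (integrable_const _) fun s hs _ =>
      (le_abs_self _).trans (hbound s hs)
  have hge : (fun _ => -‖L‖) ≤ᵐ[ν] φ :=
    ae_le_of_forall_setIntegral_le (integrable_const _) hφ fun s hs _ => by
      rw [integral_neg]
      exact neg_le_of_abs_le (hbound s hs)
  obtain ⟨φ', hφ'm, hφ'⟩ := hφ.aestronglyMeasurable
  have hL0 : -‖L‖ ≤ ‖L‖ := neg_le_self (norm_nonneg _)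
  let ψ : X → ℝ := fun x => max (-‖L‖) (min ‖L‖ (φ' x))
  have hψm : Measurable ψ := measurable_const.max (measurable_const.min hφ'm.measurable)
  have hψb : ∀ x, ψ x ∈ Set.Icc (-‖L‖) ‖L‖ := fun x =>
    ⟨le_max_left _ _, max_le hL0 (min_le_left _ _)⟩
  have hψφ : ψ =ᵐ[ν] φ := by
    filter_upwards [hle, hge, hφ'] with x h1 h2 h3
    simp only [ψ, ← h3]
    rw [min_eq_right h1, max_eq_right h2]
  have hmul : ∀ g : X → ℝ, Integrable g ν → Integrable (fun x => g x * ψ x) ν := fun g hg =>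
    hg.mul_bdd (c := ‖L‖) hψm.aestronglyMeasurable (ae_of_all _ fun x => abs_le.2 (hψb x))
  let I : (X →₁[ν] ℝ) →ₗ[ℝ] ℝ :=
    { toFun := fun f => ∫ x, f x * ψ x ∂ν
      map_add' := fun f g => by
        rw [← integral_add (hmul _ (L1.integrable_coeFn f)) (hmul _ (L1.integrable_coeFn g))]
        refine integral_congr_ae ?_
        filter_upwards [Lp.coeFn_add f g] with x hx
        rw [hx, Pi.add_apply, add_mul]
      map_smul' := fun r f => by
        rw [RingHom.id_apply, smul_eq_mul, ← integral_const_mul]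
        refine integral_congr_ae ?_
        filter_upwards [Lp.coeFn_smul r f] with x hx
        rw [hx, Pi.smul_apply, smul_eq_mul, mul_assoc] }
  let I' : StrongDual ℝ (X →₁[ν] ℝ) := I.mkContinuous ‖L‖ fun f => by
    change ‖∫ x, f x * ψ x ∂ν‖ ≤ _
    rw [L1.norm_eq_integral_norm, ← integral_const_mul]
    refine norm_integral_le_of_norm_le ((L1.integrable_coeFn f).norm.const_mul _)
      (ae_of_all _ fun x => ?_)
    rw [norm_mul, mul_comm]
    exact mul_le_mul_of_nonneg_right (abs_le.2 (hψb x)) (norm_nonneg _)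
  have hI' : ∀ (g : X → ℝ) (hg : Integrable g ν), I' (hg.toL1 g) = ∫ x, g x * ψ x ∂ν :=
    fun g hg => by
      refine integral_congr_ae ?_
      filter_upwards [hg.coeFn_toL1] with x hx
      rw [hx]
  have hLI : L = I' := by
    ext f
    induction f using Lp.induction ENNReal.one_ne_top with
    | indicatorConst c hs hμs =>
      rename_i s
      have h1 : ((Lp.simpleFunc.indicatorConst 1 hs hμs.ne c : Lp.simpleFunc ℝ 1 ν) :
          X →₁[ν] ℝ) = c • ((integrable_const (1 : ℝ)).indicator hs).toL1
            (s.indicator fun _ => (1 : ℝ)) := by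
        rw [Lp.simpleFunc.coe_indicatorConst, ← Integrable.toL1_smul']
        refine Lp.ext ?_
        refine indicatorConstLp_coeFn.trans (EventuallyEq.trans ?_ (Integrable.coeFn_toL1 _).symm)
        refine ae_of_all _ fun x => ?_
        by_cases hx : x ∈ s <;> simp [hx]
      rw [h1, map_smul, map_smul, hL s hs, hI', ← integral_indicator hs]
      congr 1
      refine integral_congr_ae ?_
      filter_upwards [hψφ] with x hx
      by_cases hxs : x ∈ s <;> simp [hxs, hx]
    | add hf hg _ h1 h2 => rw [map_add, map_add, h1, h2]
    | isClosed => exact isClosed_eq L.continuous I'.continuous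
  exact ⟨ψ, hψm, hψb, fun g hg => by rw [hLI, hI']⟩

lemma sq_sqrt_sub_sqrt_le {a b : ℝ} (ha : 0 ≤ a) (hb : 0 ≤ b) :
    (√a - √b) ^ 2 ≤ |a - b| := by
  have h : |a - b| = |√a - √b| * (√a + √b) := by
    rw [← abs_of_nonneg (add_nonneg (Real.sqrt_nonneg a) (Real.sqrt_nonneg b)), ← abs_mul]
    congr 1
    nlinarith [Real.sq_sqrt ha, Real.sq_sqrt hb]
  rw [h, ← sq_abs, sq]
  refine mul_le_mul_of_nonneg_left (abs_le.2 ⟨?_, ?_⟩) (abs_nonneg _) <;>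
    linarith [Real.sqrt_nonneg a, Real.sqrt_nonneg b]

/-- The squared Hellinger distance is at most half of the `L¹` distance of the densities, taken
with respect to any finite dominating measure. -/
lemma hellingerDist'_sq_le (μ ν P Q : Measure X) [SigmaFinite μ] [IsFiniteMeasure ν]
    [IsProbabilityMeasure P] [IsProbabilityMeasure Q] (hμν : μ ≪ ν) (hνμ : ν ≪ μ)
    (hP : P ≪ μ) (hQ : Q ≪ μ) :
    hellingerDist' μ P Q ^ 2
      ≤ (1 / 2) * ∫ x, |(P.rnDeriv ν x).toReal - (Q.rnDeriv ν x).toReal| ∂ν := by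
  have hint : Integrable (fun x => |(P.rnDeriv μ x).toReal - (Q.rnDeriv μ x).toReal|) μ :=
    (Measure.integrable_toReal_rnDeriv.sub Measure.integrable_toReal_rnDeriv).abs
  have heq : ∫ x, |(P.rnDeriv ν x).toReal - (Q.rnDeriv ν x).toReal| ∂ν
      = ∫ x, |(P.rnDeriv μ x).toReal - (Q.rnDeriv μ x).toReal| ∂μ := by
    rw [← integral_rnDeriv_smul hνμ]
    refine integral_congr_ae ?_
    filter_upwards [Measure.rnDeriv_mul_rnDeriv (κ := μ) (hP.trans hμν),
      Measure.rnDeriv_mul_rnDeriv (κ := μ) (hQ.trans hμν)] with x hxP hxQ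
    rw [← hxP, ← hxQ, Pi.mul_apply, Pi.mul_apply, ENNReal.toReal_mul, ENNReal.toReal_mul,
      ← sub_mul, abs_mul, abs_of_nonneg ENNReal.toReal_nonneg, smul_eq_mul, mul_comm]
  rw [heq, hellingerDist', Real.sq_sqrt]
  · refine mul_le_mul_of_nonneg_left ?_ (by norm_num)
    exact integral_mono_of_nonneg (ae_of_all _ fun x => sq_nonneg _) hint
      (ae_of_all _ fun x => sq_sqrt_sub_sqrt_le ENNReal.toReal_nonneg ENNReal.toReal_nonneg)
  · exact mul_nonneg (by norm_num) (integral_nonneg fun x => sq_nonneg _)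

lemma toReal_rnDeriv_convexCombo (ν P Q : Measure X) [IsFiniteMeasure ν]
    [IsProbabilityMeasure P] [IsProbabilityMeasure Q] {a b : ℝ} (ha : 0 ≤ a) (hb : 0 ≤ b) :
    (fun x => ((ENNReal.ofReal a • P + ENNReal.ofReal b • Q).rnDeriv ν x).toReal)
      =ᵐ[ν] fun x => a * (P.rnDeriv ν x).toReal + b * (Q.rnDeriv ν x).toReal := by
  have : IsFiniteMeasure (ENNReal.ofReal a • P) := P.smul_finite ENNReal.ofReal_ne_top
  have : IsFiniteMeasure (ENNReal.ofReal b • Q) := Q.smul_finite ENNReal.ofReal_ne_top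
  filter_upwards [Measure.rnDeriv_add (ENNReal.ofReal a • P) (ENNReal.ofReal b • Q) ν,
    Measure.rnDeriv_smul_left_of_ne_top P ν (ENNReal.ofReal_ne_top (r := a)),
    Measure.rnDeriv_smul_left_of_ne_top Q ν (ENNReal.ofReal_ne_top (r := b)),
    P.rnDeriv_ne_top ν, Q.rnDeriv_ne_top ν] with x h1 h2 h3 h4 h5
  rw [h1, Pi.add_apply, h2, h3, Pi.smul_apply, Pi.smul_apply, smul_eq_mul, smul_eq_mul,
    ENNReal.toReal_add (ENNReal.mul_ne_top ENNReal.ofReal_ne_top h4)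
      (ENNReal.mul_ne_top ENNReal.ofReal_ne_top h5),
    ENNReal.toReal_mul, ENNReal.toReal_mul, ENNReal.toReal_ofReal ha, ENNReal.toReal_ofReal hb]

/-- Convex classes of probability measures that are separated in Hellinger distance are
separated by the means of a bounded measurable statistic. -/
lemma exists_bounded_separating_statistic (μ : Measure X) [SigmaFinite μ]
    (M0 M1 : Set (Measure X))
    (hprob : ∀ P ∈ M0 ∪ M1, IsProbabilityMeasure P)
    (hdom : ∀ P ∈ M0 ∪ M1, P ≪ μ)
    (hconv0 : ∀ P ∈ M0, ∀ Q ∈ M0, ∀ t : ℝ, 0 ≤ t → t ≤ 1 →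
      (ENNReal.ofReal t • P + ENNReal.ofReal (1 - t) • Q) ∈ M0)
    (hconv1 : ∀ P ∈ M1, ∀ Q ∈ M1, ∀ t : ℝ, 0 ≤ t → t ≤ 1 →
      (ENNReal.ofReal t • P + ENNReal.ofReal (1 - t) • Q) ∈ M1)
    {ε : ℝ} (hε : 0 < ε) (hsep : ∀ P ∈ M0, ∀ Q ∈ M1, ε ≤ hellingerDist' μ P Q) :
    ∃ (ψ : X → ℝ) (C s u : ℝ), Measurable ψ ∧ 0 < C ∧ 0 < u ∧
      (∀ x, ψ x ∈ Set.Icc (-C) C) ∧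
      (∀ P ∈ M0, s + u ≤ ∫ x, ψ x ∂P) ∧ ∀ Q ∈ M1, ∫ x, ψ x ∂Q ≤ s := by
  obtain rfl | ⟨P₀, hP₀⟩ := M0.eq_empty_or_nonempty
  · exact ⟨fun _ => 0, 1, 0, 1, measurable_const, one_pos, one_pos, by simp, by simp, by simp⟩
  obtain rfl | ⟨Q₀, hQ₀⟩ := M1.eq_empty_or_nonempty
  · exact ⟨fun _ => 0, 1, -1, 1, measurable_const, one_pos, one_pos, by simp, by simp, by simp⟩
  let ν := μ.toFinite
  have hμν : μ ≪ ν := absolutelyContinuous_toFinite μ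
  have hνμ : ν ≪ μ := toFinite_absolutelyContinuous μ
  let D : Set (X →₁[ν] ℝ) := {g | ∃ P ∈ M0, ∃ Q ∈ M1,
    g =ᵐ[ν] fun x => (P.rnDeriv ν x).toReal - (Q.rnDeriv ν x).toReal}
  have hD : Convex ℝ D := by
    rintro g ⟨P, hP, Q, hQ, hg⟩ g' ⟨P', hP', Q', hQ', hg'⟩ a b ha hb hab
    obtain rfl : b = 1 - a := by linarith
    have := hprob P (.inl hP)
    have := hprob P' (.inl hP')
    have := hprob Q (.inr hQ)
    have := hprob Q' (.inr hQ')
    refine ⟨_, hconv0 P hP P' hP' a ha (by linarith),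
      _, hconv1 Q hQ Q' hQ' a ha (by linarith), ?_⟩
    filter_upwards [hg, hg', toReal_rnDeriv_convexCombo ν P P' ha hb,
      toReal_rnDeriv_convexCombo ν Q Q' ha hb, Lp.coeFn_add (a • g) ((1 - a) • g'),
      Lp.coeFn_smul a g, Lp.coeFn_smul (1 - a) g'] with x h1 h2 h3 h4 h5 h6 h7
    rw [h3, h4, h5, Pi.add_apply, h6, h7, Pi.smul_apply, Pi.smul_apply, h1, h2, smul_eq_mul,
      smul_eq_mul]
    ring
  have hdisj : Disjoint (Metric.ball (0 : X →₁[ν] ℝ) (2 * ε ^ 2)) D := by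
    rw [Set.disjoint_left]
    rintro g hgb ⟨P, hP, Q, hQ, hg⟩
    have := hprob P (.inl hP)
    have := hprob Q (.inr hQ)
    rw [mem_ball_zero_iff, L1.norm_eq_integral_norm] at hgb
    have h1 : ∫ x, ‖g x‖ ∂ν
        = ∫ x, |(P.rnDeriv ν x).toReal - (Q.rnDeriv ν x).toReal| ∂ν := by
      refine integral_congr_ae ?_
      filter_upwards [hg] with x hx
      rw [hx, Real.norm_eq_abs]
    have h2 := hellingerDist'_sq_le μ ν P Q hμν hνμ (hdom P (.inl hP)) (hdom Q (.inr hQ))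
    have h3 : ε ^ 2 ≤ hellingerDist' μ P Q ^ 2 := pow_le_pow_left₀ hε.le (hsep P hP Q hQ) 2
    linarith
  obtain ⟨L, u, hLu, hLD⟩ := geometric_hahn_banach_open (convex_ball _ _) Metric.isOpen_ball hD hdisj
  have hu : 0 < u := by
    simpa using hLu 0 (Metric.mem_ball_self (by positivity))
  obtain ⟨ψ, hψm, hψb, hψ⟩ := exists_bounded_integral_eq_of_L1_dual ν L
  have hgap : ∀ P ∈ M0, ∀ Q ∈ M1, u ≤ ∫ x, ψ x ∂P - ∫ x, ψ x ∂Q := fun P hP Q hQ => by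
    have := hprob P (.inl hP)
    have := hprob Q (.inr hQ)
    have hiP : Integrable (fun x => (P.rnDeriv ν x).toReal) ν := Measure.integrable_toReal_rnDeriv
    have hiQ : Integrable (fun x => (Q.rnDeriv ν x).toReal) ν := Measure.integrable_toReal_rnDeriv
    have h := hLD ((hiP.sub hiQ).toL1 _) ⟨P, hP, Q, hQ, Integrable.coeFn_toL1 _⟩
    rw [Integrable.toL1_sub _ _ hiP hiQ, map_sub, hψ, hψ] at h
    rwa [← integral_rnDeriv_smul ((hdom P (.inl hP)).trans hμν),
      ← integral_rnDeriv_smul ((hdom Q (.inr hQ)).trans hμν)]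
  refine ⟨ψ, ‖L‖ + 1, sSup ((fun Q => ∫ x, ψ x ∂Q) '' M1), u, hψm, by positivity, hu,
    fun x => ⟨by linarith [(hψb x).1], by linarith [(hψb x).2]⟩, fun P hP => ?_, fun Q hQ => ?_⟩
  · rw [← le_sub_iff_add_le]
    refine csSup_le (Set.Nonempty.image _ ⟨Q₀, hQ₀⟩) ?_
    rintro _ ⟨Q, hQ, rfl⟩
    linarith [hgap P hP Q hQ]
  · refine le_csSup ⟨∫ x, ψ x ∂P₀, ?_⟩ (Set.mem_image_of_mem _ hQ)
    rintro _ ⟨Q', hQ', rfl⟩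
    linarith [hgap P₀ hP₀ Q' hQ']

/-- Hoeffding's inequality for a bounded statistic of an i.i.d. sample. -/
lemma pi_sum_ge_le_of_integral_le (P : Measure X) [IsProbabilityMeasure P] {ψ : X → ℝ}
    (hψ : Measurable ψ) {C t d : ℝ} (hC : 0 < C) (hψC : ∀ x, ψ x ∈ Set.Icc (-C) C)
    (hd : 0 ≤ d) (ht : ∫ x, ψ x ∂P ≤ t - d) (n : ℕ) :
    Measure.pi (fun _ : Fin n => P) {x | n * t ≤ ∑ i, ψ (x i)}
      ≤ ENNReal.ofReal (Real.exp (-(n * d ^ 2 / (2 * C ^ 2)))) := by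
  let Z : X → ℝ := fun x => ψ x - ∫ y, ψ y ∂P
  have hZ : Measurable Z := hψ.sub_const _
  have hindep := ProbabilityTheory.iIndepFun_pi (μ := fun _ : Fin n => P)
    (X := fun _ => Z) fun _ => hZ.aemeasurable
  have hsub : ProbabilityTheory.HasSubgaussianMGF Z ((‖C - -C‖₊ / 2) ^ 2) P :=
    ProbabilityTheory.hasSubgaussianMGF_of_mem_Icc hψ.aemeasurable (ae_of_all _ hψC)
  have hsub' : ∀ i ∈ (Finset.univ : Finset (Fin n)), ProbabilityTheory.HasSubgaussianMGF
      (fun x : Fin n → X => Z (x i)) ((‖C - -C‖₊ / 2) ^ 2) (Measure.pi fun _ => P) := fun i _ => by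
    have hmp := measurePreserving_eval (fun _ : Fin n => P) i
    exact ProbabilityTheory.HasSubgaussianMGF.of_map (Y := fun x : Fin n → X => x i)
      (measurable_pi_apply i).aemeasurable (by rw [hmp.map_eq]; exact hsub)
  have h := ProbabilityTheory.HasSubgaussianMGF.measure_sum_ge_le_of_iIndepFun hindep hsub'
    (ε := n * d) (by positivity)
  rw [← ENNReal.ofReal_toReal (measure_ne_top (Measure.pi fun _ : Fin n => P) _)]
  refine ENNReal.ofReal_le_ofReal ?_
  refine (measureReal_mono (fun x hx => ?_)).trans (h.trans_eq ?_)
  · simp only [Set.mem_ofPred_eq, Z, Finset.sum_sub_distrib, Finset.sum_const, Finset.card_univ,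
      Fintype.card_fin, nsmul_eq_mul] at hx ⊢
    nlinarith [mul_le_mul_of_nonneg_left ht (Nat.cast_nonneg (α := ℝ) n)]
  · congr 1
    have hc : ‖C - -C‖ / 2 = C := by
      rw [sub_neg_eq_add, Real.norm_of_nonneg (by positivity)]
      ring
    simp only [Finset.sum_const, Finset.card_univ, Fintype.card_fin, nsmul_eq_mul,
      NNReal.coe_mul, NNReal.coe_natCast, NNReal.coe_pow, NNReal.coe_div, coe_nnnorm,
      NNReal.coe_ofNat, hc]
    rcases Nat.eq_zero_or_pos n with rfl | hn
    · simp
    · have : (n : ℝ) ≠ 0 := by positivity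
      field_simp

end Separation

/-- **Separated regimes admit exponentially consistent tests.**
If `M0, M1` are convex classes of probability measures dominated by a
σ-finite measure `μ` and `inf_{P ∈ M0, Q ∈ M1} h(P,Q) ≥ ε > 0`, then there
are a constant `c > 0` and tests `φ_n : Xⁿ → {0,1}` with
`α_n(φ_n) ≤ exp(−cnε²)` and `β_n(φ_n) ≤ exp(−cnε²)` for all `n`. -/
theorem separated_regimes_admit_tests
    {X : Type*} [MeasurableSpace X] (μ : Measure X) [SigmaFinite μ]
    (M0 M1 : Set (Measure X))
    (hprob : ∀ P ∈ M0 ∪ M1, IsProbabilityMeasure P)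
    (hdom : ∀ P ∈ M0 ∪ M1, P ≪ μ)
    (hconv0 : ∀ P ∈ M0, ∀ Q ∈ M0, ∀ t : ℝ, 0 ≤ t → t ≤ 1 →
      (ENNReal.ofReal t • P + ENNReal.ofReal (1 - t) • Q) ∈ M0)
    (hconv1 : ∀ P ∈ M1, ∀ Q ∈ M1, ∀ t : ℝ, 0 ≤ t → t ≤ 1 →
      (ENNReal.ofReal t • P + ENNReal.ofReal (1 - t) • Q) ∈ M1)
    (ε : ℝ) (hε : 0 < ε)
    (hsep : ∀ P ∈ M0, ∀ Q ∈ M1, ε ≤ hellingerDist' μ P Q) :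
    ∃ c > (0 : ℝ), ∃ φ : (n : ℕ) → (Fin n → X) → Bool,
      (∀ n, Measurable (φ n)) ∧
      (∀ n : ℕ,
        (⨆ P ∈ M0, Measure.pi (fun _ : Fin n => P) {x | φ n x = true})
          ≤ ENNReal.ofReal (Real.exp (-c * n * ε ^ 2)) ∧
        (⨆ Q ∈ M1, Measure.pi (fun _ : Fin n => Q) {x | φ n x = false})
          ≤ ENNReal.ofReal (Real.exp (-c * n * ε ^ 2))) := by
  obtain ⟨ψ, C, s, u, hψm, hC, hu, hψC, hM0, hM1⟩ :=
    exists_bounded_separating_statistic μ M0 M1 hprob hdom hconv0 hconv1 hε hsep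
  have hsum : ∀ n : ℕ, Measurable fun x : Fin n → X => ∑ i, ψ (x i) := fun n =>
    Finset.measurable_sum _ fun i _ => hψm.comp (measurable_pi_apply i)
  have hexp : ∀ n : ℕ, -(n * (u / 2) ^ 2 / (2 * C ^ 2))
      = -((u / 2) ^ 2 / (2 * C ^ 2 * ε ^ 2)) * n * ε ^ 2 := fun n => by
    field_simp
  refine ⟨(u / 2) ^ 2 / (2 * C ^ 2 * ε ^ 2), by positivity,
    fun n x => decide (∑ i, ψ (x i) ≤ n * (s + u / 2)), fun n => ?_, fun n => ⟨?_, ?_⟩⟩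
  · refine measurable_to_bool ?_
    simpa [Set.preimage] using measurableSet_le (hsum n) measurable_const
  · refine iSup₂_le fun P hP => ?_
    have := hprob P (.inl hP)
    have h := pi_sum_ge_le_of_integral_le P hψm.neg (t := -(s + u / 2)) (d := u / 2) hC
      (fun x => ⟨neg_le_neg (hψC x).2, neg_le.1 (hψC x).1⟩) (by positivity)
      (by simp only [Pi.neg_apply, integral_neg]; linarith [hM0 P hP]) n
    rw [hexp] at h
    refine (measure_mono fun x hx => ?_).trans h
    simp only [Set.mem_ofPred_eq, decide_eq_true_eq, Pi.neg_apply, Finset.sum_neg_distrib] at hx ⊢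
    linarith
  · refine iSup₂_le fun Q hQ => ?_
    have := hprob Q (.inr hQ)
    have h := pi_sum_ge_le_of_integral_le Q hψm (t := s + u / 2) (d := u / 2) hC hψC
      (by positivity) (by linarith [hM1 Q hQ]) n
    rw [hexp] at h
    refine (measure_mono fun x hx => ?_).trans h
    simp only [Set.mem_ofPred_eq, decide_eq_false_iff_not, not_le] at hx ⊢
    exact hx.le
end

section
/- Let (P_n) and (Q_n) be sequences of probability measures on a measurable space X, each pair dominated by a σ-finite measure, and suppose n · h²(P_n, Q_n) → 0 as n → ∞. Then for every sequence of tests φ_n : Xⁿ → {0,1}, P_nⁿ(φ_n = 1) + Q_nⁿ(φ_n = 0) → 1; that is, along such local sequences the null and alternative are asymptotically indistinguishable. Conversely, if n · h²(P_n, Q_n) → ∞, then there exists a sequence of tests φ_n with P_nⁿ(φ_n = 1) → 0 and Q_nⁿ(φ_n = 0) → 0, with both errors bounded by exp(−n · h²(P_n, Q_n)). -/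
open MeasureTheory Filter

/-- `P` has the nonnegative integrable real density `f` with respect to `ν`. -/
structure HasRealDensity {Y : Type*} [MeasurableSpace Y] (P ν : Measure Y) (f : Y → ℝ) :
    Prop where
  measurable : Measurable f
  nonneg : ∀ x, 0 ≤ f x
  integrable : Integrable f ν
  eq_withDensity : P = ν.withDensity fun x ↦ ENNReal.ofReal (f x)

namespace HasRealDensity

variable {Y : Type*} [MeasurableSpace Y] {P Q ν : Measure Y} {f g : Y → ℝ}

lemma rnDeriv [SigmaFinite ν] [IsFiniteMeasure P] (h : P ≪ ν) :
    HasRealDensity P ν fun x ↦ (P.rnDeriv ν x).toReal where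
  measurable := (Measure.measurable_rnDeriv P ν).ennreal_toReal
  nonneg _ := ENNReal.toReal_nonneg
  integrable := Measure.integrable_toReal_rnDeriv
  eq_withDensity := by
    conv_lhs => rw [← Measure.withDensity_rnDeriv_eq P ν h]
    refine withDensity_congr_ae ?_
    filter_upwards [Measure.rnDeriv_ne_top P ν] with x hx
    rw [ENNReal.ofReal_toReal hx]

lemma apply_eq (hf : HasRealDensity P ν f) {s : Set Y} (hs : MeasurableSet s) :
    P s = ENNReal.ofReal (∫ x in s, f x ∂ν) := by
  rw [hf.eq_withDensity, withDensity_apply _ hs,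
    ofReal_integral_eq_lintegral_ofReal hf.integrable.integrableOn (.of_forall hf.nonneg)]

lemma real_eq (hf : HasRealDensity P ν f) {s : Set Y} (hs : MeasurableSet s) :
    P.real s = ∫ x in s, f x ∂ν := by
  rw [Measure.real, hf.apply_eq hs,
    ENNReal.toReal_ofReal (integral_nonneg hf.nonneg)]

lemma integral_eq_one [IsProbabilityMeasure P] (hf : HasRealDensity P ν f) :
    ∫ x, f x ∂ν = 1 := by
  rw [← setIntegral_univ, ← hf.real_eq .univ, probReal_univ]

lemma pi [SigmaFinite ν] [SigmaFinite P] (hf : HasRealDensity P ν f) (ι : Type*) [Fintype ι] :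
    HasRealDensity (Measure.pi fun _ : ι ↦ P) (Measure.pi fun _ ↦ ν)
      fun x ↦ ∏ i, f (x i) where
  measurable := Finset.measurable_prod _ fun i _ ↦ hf.measurable.comp (measurable_pi_apply i)
  nonneg x := Finset.prod_nonneg fun i _ ↦ hf.nonneg _
  integrable := .fintype_prod fun _ ↦ hf.integrable
  eq_withDensity := by
    refine (Measure.pi_eq fun s hs ↦ ?_)
    have hS : MeasurableSet (Set.univ.pi s) := .univ_pi hs
    have hind : (Set.univ.pi s).indicator (fun x : ι → Y ↦ ∏ i, f (x i)) =
        fun x ↦ ∏ i, (s i).indicator f (x i) := by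
      ext x
      by_cases hx : x ∈ Set.univ.pi s
      · rw [Set.indicator_of_mem hx]
        exact Finset.prod_congr rfl fun i _ ↦ (Set.indicator_of_mem (hx i trivial) f).symm
      · rw [Set.indicator_of_notMem hx]
        obtain ⟨i, hi⟩ : ∃ i, x i ∉ s i := by simpa [Set.mem_univ_pi] using hx
        exact (Finset.prod_eq_zero (Finset.mem_univ i) (Set.indicator_of_notMem hi f)).symm
    rw [withDensity_apply _ hS, ← ofReal_integral_eq_lintegral_ofReal
      (Integrable.fintype_prod fun _ ↦ hf.integrable).integrableOn
      (.of_forall fun x ↦ Finset.prod_nonneg fun i _ ↦ hf.nonneg _),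
      ← integral_indicator hS, hind, integral_fintype_prod_eq_prod,
      ENNReal.ofReal_prod_of_nonneg fun i _ ↦
        integral_nonneg (Set.indicator_nonneg fun x _ ↦ hf.nonneg x)]
    refine Finset.prod_congr rfl fun i _ ↦ ?_
    rw [integral_indicator (hs i), hf.apply_eq (hs i)]

lemma integrable_sqrt_mul_sqrt (hf : HasRealDensity P ν f) (hg : HasRealDensity Q ν g) :
    Integrable (fun x ↦ √(f x) * √(g x)) ν := by
  refine (hf.integrable.add hg.integrable).mono'
    (hf.measurable.sqrt.mul hg.measurable.sqrt).aestronglyMeasurable (.of_forall fun x ↦ ?_)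
  rw [Real.norm_of_nonneg (by positivity)]
  change _ ≤ f x + g x
  nlinarith [Real.sq_sqrt (hf.nonneg x), Real.sq_sqrt (hg.nonneg x),
    sq_nonneg (√(f x) - √(g x)), hf.nonneg x, hg.nonneg x]

/-- The squared Hellinger integral is determined by the Hellinger affinity. -/
lemma integral_sqrt_sub_sqrt_sq [IsProbabilityMeasure P] [IsProbabilityMeasure Q]
    (hf : HasRealDensity P ν f) (hg : HasRealDensity Q ν g) :
    1 / 2 * ∫ x, (√(f x) - √(g x)) ^ 2 ∂ν = 1 - ∫ x, √(f x) * √(g x) ∂ν := by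
  have h : ∀ x, (√(f x) - √(g x)) ^ 2 = f x + g x - 2 * (√(f x) * √(g x)) := fun x ↦ by
    linear_combination Real.sq_sqrt (hf.nonneg x) + Real.sq_sqrt (hg.nonneg x)
  simp_rw [h]
  have hfg : Integrable (fun x ↦ f x + g x) ν := hf.integrable.add hg.integrable
  rw [integral_sub hfg
    ((hf.integrable_sqrt_mul_sqrt hg).const_mul 2), integral_add hf.integrable hg.integrable,
    integral_const_mul, hf.integral_eq_one, hg.integral_eq_one]
  ring

/-- A region where `f ≤ g` has `P`-measure at most the Hellinger affinity. -/
lemma apply_le_affinity (hf : HasRealDensity P ν f) (hg : HasRealDensity Q ν g) {s : Set Y}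
    (hs : MeasurableSet s) (hle : ∀ x ∈ s, f x ≤ g x) :
    P s ≤ ENNReal.ofReal (∫ x, √(f x) * √(g x) ∂ν) := by
  rw [hf.apply_eq hs]
  have hi := hf.integrable_sqrt_mul_sqrt hg
  refine ENNReal.ofReal_le_ofReal ((setIntegral_mono_on hf.integrable.integrableOn
    hi.integrableOn hs fun x hx ↦ ?_).trans
      (setIntegral_le_integral hi (.of_forall fun x ↦ by positivity)))
  calc f x = √(f x) * √(f x) := (Real.mul_self_sqrt (hf.nonneg x)).symm
    _ ≤ √(f x) * √(g x) := by gcongr; exact hle x hx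

lemma abs_real_sub_real_le [IsProbabilityMeasure P] [IsProbabilityMeasure Q]
    (hf : HasRealDensity P ν f) (hg : HasRealDensity Q ν g) {s : Set Y}
    (hs : MeasurableSet s) {ε : ℝ} (hε : 0 < ε) :
    |P.real s - Q.real s| ≤ (1 - ∫ x, √(f x) * √(g x) ∂ν) / ε +
      ε * (1 + ∫ x, √(f x) * √(g x) ∂ν) := by
  have hi := hf.integrable_sqrt_mul_sqrt hg
  have hfg : Integrable (fun x ↦ f x + g x) ν := hf.integrable.add hg.integrable
  have h1 : Integrable (fun x ↦ (2 * ε)⁻¹ * (f x + g x - 2 * (√(f x) * √(g x)))) ν :=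
    (hfg.sub (hi.const_mul 2)).const_mul _
  have h2 : Integrable (fun x ↦ ε / 2 * (f x + g x + 2 * (√(f x) * √(g x)))) ν :=
    (hfg.add (hi.const_mul 2)).const_mul _
  have hd : Integrable (fun x ↦ |f x - g x|) ν := (hf.integrable.sub hg.integrable).abs
  have hpt : ∀ x, |f x - g x| ≤ (2 * ε)⁻¹ * (f x + g x - 2 * (√(f x) * √(g x))) +
      ε / 2 * (f x + g x + 2 * (√(f x) * √(g x))) := fun x ↦ by
    obtain ⟨a, b, ha, hb, hfa, hgb⟩ : ∃ a b : ℝ, √(f x) = a ∧ √(g x) = b ∧ f x = a ^ 2 ∧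
        g x = b ^ 2 :=
      ⟨_, _, rfl, rfl, (Real.sq_sqrt (hf.nonneg x)).symm, (Real.sq_sqrt (hg.nonneg x)).symm⟩
    have key : ∀ u v : ℝ, u * v ≤ (2 * ε)⁻¹ * u ^ 2 + ε / 2 * v ^ 2 := fun u v ↦ by
      have : (2 * ε)⁻¹ * u ^ 2 + ε / 2 * v ^ 2 - u * v = (2 * ε)⁻¹ * (u - ε * v) ^ 2 := by
        field_simp
        ring
      have : 0 ≤ (2 * ε)⁻¹ * (u - ε * v) ^ 2 := by positivity
      linarith
    rw [ha, hb, hfa, hgb, abs_le]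
    constructor
    · linear_combination key (b - a) (a + b)
    · linear_combination key (a - b) (a + b)
  calc |P.real s - Q.real s| = |∫ x in s, (f x - g x) ∂ν| := by
        rw [hf.real_eq hs, hg.real_eq hs,
          integral_sub hf.integrable.integrableOn hg.integrable.integrableOn]
    _ ≤ ∫ x in s, |f x - g x| ∂ν := abs_integral_le_integral_abs
    _ ≤ ∫ x, |f x - g x| ∂ν := setIntegral_le_integral hd (.of_forall fun x ↦ abs_nonneg _)
    _ ≤ _ := integral_mono hd (h1.add h2) hpt
    _ = _ := by
        rw [integral_add' h1 h2, integral_const_mul, integral_const_mul,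
          integral_sub hfg (hi.const_mul 2), integral_add hfg (hi.const_mul 2),
          integral_add hf.integrable hg.integrable, integral_const_mul,
          hf.integral_eq_one, hg.integral_eq_one]
        field_simp
        ring

lemma affinity_pi [SigmaFinite ν] (f g : Y → ℝ) (hf : ∀ x, 0 ≤ f x) (hg : ∀ x, 0 ≤ g x)
    (n : ℕ) :
    ∫ x : Fin n → Y, √(∏ i, f (x i)) * √(∏ i, g (x i)) ∂(Measure.pi fun _ ↦ ν) =
      (∫ x, √(f x) * √(g x) ∂ν) ^ n := by
  rw [← Fintype.card_fin n, ← integral_fintype_prod_eq_pow, Fintype.card_fin]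
  simp_rw [Finset.prod_mul_distrib, Real.sqrt_eq_rpow]
  congr! with x
  · exact (Real.finsetProd_rpow _ _ (fun i _ ↦ hf _) _).symm
  · exact (Real.finsetProd_rpow _ _ (fun i _ ↦ hg _) _).symm

end HasRealDensity

lemma one_sub_hellingerDist'_sq {X : Type*} [MeasurableSpace X] {μ P Q : Measure X}
    [SigmaFinite μ] [IsProbabilityMeasure P] [IsProbabilityMeasure Q] (hP : P ≪ μ)
    (hQ : Q ≪ μ) :
    ∫ x, √((P.rnDeriv μ x).toReal) * √((Q.rnDeriv μ x).toReal) ∂μ =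
      1 - hellingerDist' μ P Q ^ 2 := by
  rw [hellingerDist', Real.sq_sqrt
    (mul_nonneg (by norm_num) (integral_nonneg fun x ↦ sq_nonneg _)),
    (HasRealDensity.rnDeriv hP).integral_sqrt_sub_sqrt_sq (HasRealDensity.rnDeriv hQ)]
  ring

/-- **Scale-dependent detectability along local sequences.**
Let `(P_n)`, `(Q_n)` be sequences of probability measures, each pair
dominated by a σ-finite measure `μ_n`.  If `n·h²(P_n,Q_n) → 0`, then for
every sequence of tests `φ_n : Xⁿ → {0,1}`,
`P_nⁿ(φ_n = 1) + Q_nⁿ(φ_n = 0) → 1` (asymptotic indistinguishability).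
Conversely, if `n·h²(P_n,Q_n) → ∞`, then there exist tests `φ_n` with both
errors bounded by `exp(−n·h²(P_n,Q_n))`, hence both tending to `0`. -/
theorem local_sequences_detectability
    {X : Type*} [MeasurableSpace X]
    (P Q : ℕ → Measure X) (μ : ℕ → Measure X)
    (hσ : ∀ n, SigmaFinite (μ n))
    (hP : ∀ n, IsProbabilityMeasure (P n)) (hQ : ∀ n, IsProbabilityMeasure (Q n))
    (hPμ : ∀ n, P n ≪ μ n) (hQμ : ∀ n, Q n ≪ μ n) :
    (Tendsto (fun n : ℕ => (n : ℝ) * hellingerDist' (μ n) (P n) (Q n) ^ 2)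
        atTop (nhds 0) →
      ∀ φ : (n : ℕ) → (Fin n → X) → Bool, (∀ n, Measurable (φ n)) →
        Tendsto (fun n : ℕ =>
          ((Measure.pi fun _ : Fin n => P n) {x | φ n x = true}).toReal +
          ((Measure.pi fun _ : Fin n => Q n) {x | φ n x = false}).toReal)
          atTop (nhds 1)) ∧
    (Tendsto (fun n : ℕ => (n : ℝ) * hellingerDist' (μ n) (P n) (Q n) ^ 2)
        atTop atTop →
      ∃ φ : (n : ℕ) → (Fin n → X) → Bool,
        (∀ n, Measurable (φ n)) ∧
        (∀ n : ℕ,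
          (Measure.pi fun _ : Fin n => P n) {x | φ n x = true}
            ≤ ENNReal.ofReal
                (Real.exp (-(n : ℝ) * hellingerDist' (μ n) (P n) (Q n) ^ 2)) ∧
          (Measure.pi fun _ : Fin n => Q n) {x | φ n x = false}
            ≤ ENNReal.ofReal
                (Real.exp (-(n : ℝ) * hellingerDist' (μ n) (P n) (Q n) ^ 2))) ∧
        Tendsto (fun n : ℕ =>
          (Measure.pi fun _ : Fin n => P n) {x | φ n x = true}) atTop (nhds 0) ∧
        Tendsto (fun n : ℕ =>
          (Measure.pi fun _ : Fin n => Q n) {x | φ n x = false}) atTop (nhds 0)) := by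
  have hf n := HasRealDensity.rnDeriv (hPμ n)
  have hg n := HasRealDensity.rnDeriv (hQμ n)
  have hF n := (hf n).pi (Fin n)
  have hG n := (hg n).pi (Fin n)
  have haff n := HasRealDensity.affinity_pi (ν := μ n) _ _ (hf n).nonneg (hg n).nonneg n
  simp_rw [one_sub_hellingerDist'_sq (hPμ _) (hQμ _)] at haff
  have hle n : hellingerDist' (μ n) (P n) (Q n) ^ 2 ≤ 1 := by
    have h : 0 ≤ ∫ x, √(((P n).rnDeriv (μ n) x).toReal) *
        √(((Q n).rnDeriv (μ n) x).toReal) ∂μ n :=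
      integral_nonneg fun x ↦ by positivity
    rw [one_sub_hellingerDist'_sq (hPμ n) (hQμ n)] at h
    linarith
  refine ⟨fun hlim φ hφ ↦ ?_, fun hlim ↦ ?_⟩
  · rw [Metric.tendsto_nhds]
    intro ε hε
    filter_upwards [hlim.eventually_lt_const (show 0 < (ε / 4) ^ 2 by positivity)] with n hn
    have hs : MeasurableSet {x | φ n x = true} := hφ n (measurableSet_singleton true)
    have hc : {x | φ n x = false} = {x | φ n x = true}ᶜ := by ext; simp
    have hbound := (hF n).abs_real_sub_real_le (hG n) hs (show 0 < ε / 4 by positivity)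
    rw [haff] at hbound
    have hbern := one_add_mul_le_pow
      (show -2 ≤ -hellingerDist' (μ n) (P n) (Q n) ^ 2 by linarith [hle n]) n
    have hpow : (1 - hellingerDist' (μ n) (P n) (Q n) ^ 2) ^ n ≤ 1 :=
      pow_le_one₀ (by linarith [hle n])
        (by linarith [sq_nonneg (hellingerDist' (μ n) (P n) (Q n))])
    rw [← sub_eq_add_neg] at hbern
    have hdiv : (1 - (1 - hellingerDist' (μ n) (P n) (Q n) ^ 2) ^ n) / (ε / 4) < ε / 4 := by
      rw [div_lt_iff₀ (by positivity)]
      linarith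
    rw [hc, ← measureReal_def, ← measureReal_def, probReal_compl_eq_one_sub hs, Real.dist_eq]
    calc _ = |(Measure.pi fun _ : Fin n ↦ P n).real {x | φ n x = true} -
          (Measure.pi fun _ : Fin n ↦ Q n).real {x | φ n x = true}| := by congr 1; ring
      _ < ε := by nlinarith
  · have hexp n : (1 - hellingerDist' (μ n) (P n) (Q n) ^ 2) ^ n ≤
        Real.exp (-(n : ℝ) * hellingerDist' (μ n) (P n) (Q n) ^ 2) := by
      rw [neg_mul_comm, Real.exp_nat_mul]
      exact pow_le_pow_left₀ (by linarith [hle n]) (Real.one_sub_le_exp_neg _) n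
    have hlim0 : Tendsto (fun n : ℕ ↦ ENNReal.ofReal
        (Real.exp (-(n : ℝ) * hellingerDist' (μ n) (P n) (Q n) ^ 2))) atTop (nhds 0) := by
      rw [← ENNReal.ofReal_zero]
      simp_rw [neg_mul]
      exact ENNReal.tendsto_ofReal (Real.tendsto_exp_neg_atTop_nhds_zero.comp hlim)
    set F : (n : ℕ) → (Fin n → X) → ℝ := fun n x ↦
      ∏ i, ((P n).rnDeriv (μ n) (x i)).toReal
    set G : (n : ℕ) → (Fin n → X) → ℝ := fun n x ↦
      ∏ i, ((Q n).rnDeriv (μ n) (x i)).toReal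
    have hs n : MeasurableSet {x | F n x < G n x} :=
      measurableSet_lt (hF n).measurable (hG n).measurable
    have hs' n : MeasurableSet {x | G n x ≤ F n x} :=
      measurableSet_le (hG n).measurable (hF n).measurable
    have h1 n : (Measure.pi fun _ : Fin n ↦ P n) {x | F n x < G n x} ≤ ENNReal.ofReal
        (Real.exp (-(n : ℝ) * hellingerDist' (μ n) (P n) (Q n) ^ 2)) := by
      refine ((hF n).apply_le_affinity (hG n) (hs n) fun x hx ↦ le_of_lt hx).trans ?_
      rw [haff]
      exact ENNReal.ofReal_le_ofReal (hexp n)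
    have h2 n : (Measure.pi fun _ : Fin n ↦ Q n) {x | G n x ≤ F n x} ≤ ENNReal.ofReal
        (Real.exp (-(n : ℝ) * hellingerDist' (μ n) (P n) (Q n) ^ 2)) := by
      refine ((hG n).apply_le_affinity (hF n) (hs' n) fun x hx ↦ hx).trans ?_
      simp_rw [mul_comm (√(∏ i, ((Q n).rnDeriv _ _).toReal))]
      rw [haff]
      exact ENNReal.ofReal_le_ofReal (hexp n)
    refine ⟨fun n x ↦ decide (F n x < G n x), fun n ↦ measurable_to_bool ?_, ?_⟩
    · simpa [Set.preimage] using hs n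
    · simp only [decide_eq_true_eq, decide_eq_false_iff_not, not_lt]
      exact ⟨fun n ↦ ⟨h1 n, h2 n⟩,
        tendsto_of_tendsto_of_tendsto_of_le_of_le tendsto_const_nhds hlim0 (fun _ ↦ zero_le) h1,
        tendsto_of_tendsto_of_tendsto_of_le_of_le tendsto_const_nhds hlim0 (fun _ ↦ zero_le) h2⟩
end
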